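/- Let n ∈ ℕ, fix x₀ ∈ ℝ^n with ‖x₀‖ = 1, and let c_g be a positive constant with the order-statistics property below. Let m ∈ ℕ and 0 < β ≤ 1/2 be such that βm is an integer, let ε̃ > 0 and 0 < ε ≤ 1, and let A be an m×n Gaussian random matrix. If δ := c_g√(β ln(2/β)) − √((1 − ε)β + ε + ε̃) > 0, then P(Ω_{ε,β}) ≤ e^{−ε̃²m/4} + e^{−δ²m/2}. -/

import Mathlib

open MeasureTheory ProbabilityTheory Real

/-- The canonical probability space of `m` i.i.d. standard Gaussian random variables. -/
noncomputable def stdGaussianPi (m : ℕ) : Measure (Fin m → ℝ) :=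
  Measure.pi fun _ => gaussianReal 0 1

/-- The law of an `m × n` Gaussian random matrix with i.i.d. `N(0,1)` entries. -/
noncomputable def gaussianMatrix (m n : ℕ) : Measure (Fin m → Fin n → ℝ) :=
  Measure.pi fun _ => Measure.pi fun _ => gaussianReal 0 1

/-- `absOrd y j = |Y_(j+1)|`: the `(j+1)`-st largest among `|y 0|, …, |y (m-1)|`. -/
noncomputable def absOrd {m : ℕ} (y : Fin m → ℝ) (j : Fin m) : ℝ :=
  |y (Tuple.sort (fun i => -|y i|) j)|

/-- `c` has the order-statistics property: `c √(ln(2m/(j+1))) ≤ E|Y_(j+1)|` for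
all `m` and all `j+1 ≤ m/2`. -/
def cgProperty (c : ℝ) : Prop :=
  ∀ (m : ℕ) (j : Fin m), 2 * ((j : ℕ) + 1) ≤ m →
    c * Real.sqrt (Real.log (2 * m / ((j : ℕ) + 1))) ≤ ∫ y, absOrd y j ∂(stdGaussianPi m)

/-- `‖A_T x‖²`. -/
noncomputable def subNormSq {m n : ℕ} (A : Fin m → Fin n → ℝ) (x : Fin n → ℝ)
    (T : Finset (Fin m)) : ℝ :=
  ∑ i ∈ T, (∑ j, A i j * x j) ^ 2

/-- The event `Ω_{ε,β}`. -/
def omegaEvent (m n : ℕ) (x₀ : Fin n → ℝ) (ε β : ℝ) : Set (Fin m → Fin n → ℝ) :=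
  {A | ∀ T : Finset (Fin m), (Tᶜ.card : ℝ) ≤ β * m →
    |(1 / (T.card : ℝ)) * subNormSq A x₀ T - 1| ≤ ε}

/-- The one-dimensional Brunn–Minkowski inequality. -/
theorem volume_add_le_of_forall_add_mem {A B C : Set ℝ} (hA : MeasurableSet A)
    (hB : MeasurableSet B) (hA' : A.Nonempty) (hB' : B.Nonempty)
    (hC : ∀ a ∈ A, ∀ b ∈ B, a + b ∈ C) : volume A + volume B ≤ volume C := by
  rw [hA.measure_eq_iSup_isCompact volume, hB.measure_eq_iSup_isCompact volume]
  simp only [iSup_and']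
  refine ENNReal.biSup_add_biSup_le' (p := fun K => K ⊆ A ∧ IsCompact K)
    (q := fun L => L ⊆ B ∧ IsCompact L) ⟨∅, by simp⟩ ⟨∅, by simp⟩ ?_
  rintro K ⟨hKA, hK⟩ L ⟨hLB, hL⟩
  rcases K.eq_empty_or_nonempty with rfl | hKne
  · obtain ⟨a, ha⟩ := hA'
    rw [measure_empty, zero_add, ← measure_preimage_add volume (-a) L]
    refine measure_mono fun x hx => ?_
    simpa using hC a ha _ (hLB hx)
  rcases L.eq_empty_or_nonempty with rfl | hLne
  · obtain ⟨b, hb⟩ := hB'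
    rw [measure_empty, add_zero, ← measure_preimage_add volume (-b) K]
    refine measure_mono fun x hx => ?_
    simpa using hC _ (hKA hx) b hb
  obtain ⟨a, haK, ha⟩ := hK.exists_isGreatest hKne
  obtain ⟨b, hbL, hb⟩ := hL.exists_isLeast hLne
  have hdisj : volume (((fun x => -b + x) ⁻¹' K) ∩ ((fun x => -a + x) ⁻¹' L)) = 0 := by
    refine measure_mono_null (t := {a + b}) ?_ (by simp)
    rintro x ⟨hxK, hxL⟩
    have h1 := ha hxK
    have h2 := hb hxL
    simp only [Set.mem_singleton_iff]
    linarith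
  rw [← measure_preimage_add volume (-b) K, ← measure_preimage_add volume (-a) L,
    ← measure_union_add_inter _ ((measurable_const_add (-a)) hL.measurableSet), hdisj, add_zero]
  refine measure_mono ?_
  rintro x (hx | hx)
  · simpa using hC _ (hKA hx) b (hLB hbL)
  · simpa using hC a (hKA haK) _ (hLB hx)

theorem volume_const_mul_preimage_inv {c : ℝ} (hc : 0 < c) (A : Set ℝ) :
    volume ((fun x => c⁻¹ * x) ⁻¹' A) = ENNReal.ofReal c * volume A := by
  rw [Real.volume_preimage_mul_left (inv_ne_zero hc.ne'), inv_inv, abs_of_pos hc]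

theorem lintegral_eq_lintegral_meas_lt_Ioo {f : ℝ → ℝ} (hf : Measurable f) (hf0 : ∀ x, 0 ≤ f x)
    (hf1 : ∀ x, f x ≤ 1) :
    ∫⁻ x, ENNReal.ofReal (f x) = ∫⁻ t in Set.Ioo (0 : ℝ) 1, volume {x | t < f x} := by
  rw [lintegral_eq_lintegral_meas_lt volume (Filter.Eventually.of_forall hf0) hf.aemeasurable,
    ← Set.Ioo_union_Ici_eq_Ioi (zero_lt_one' ℝ),
    lintegral_union measurableSet_Ici
      (Set.disjoint_left.2 fun x hx hx' => (hx.2.not_ge hx').elim)]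
  rw [setLIntegral_congr_fun (g := fun _ => 0) measurableSet_Ici, lintegral_zero, add_zero]
  intro t ht
  have : {x | t < f x} = ∅ := by
    ext x
    simpa using (hf1 x).trans ht
  simp [this]

/-- The additive form of the one-dimensional Prékopa–Leindler inequality, for functions with
supremum `1`. -/
theorem lintegral_add_le_of_prekopa_leindler {s : ℝ} (hs0 : 0 < s) (hs1 : s < 1) {f g h : ℝ → ℝ}
    (hf : Measurable f) (hg : Measurable g) (hh : Measurable h)
    (hf0 : ∀ x, 0 ≤ f x) (hg0 : ∀ x, 0 ≤ g x) (hh0 : ∀ x, 0 ≤ h x)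
    (hf1 : ∀ x, f x ≤ 1) (hg1 : ∀ x, g x ≤ 1) (hh1 : ∀ x, h x ≤ 1)
    (hf2 : ∀ t < 1, ∃ x, t < f x) (hg2 : ∀ t < 1, ∃ x, t < g x)
    (H : ∀ x y, f x ^ (1 - s) * g y ^ s ≤ h ((1 - s) * x + s * y)) :
    ENNReal.ofReal (1 - s) * (∫⁻ x, ENNReal.ofReal (f x)) +
      ENNReal.ofReal s * (∫⁻ x, ENNReal.ofReal (g x)) ≤ ∫⁻ x, ENNReal.ofReal (h x) := by
  have h1s : 0 < 1 - s := sub_pos.2 hs1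
  rw [lintegral_eq_lintegral_meas_lt_Ioo hf hf0 hf1, lintegral_eq_lintegral_meas_lt_Ioo hg hg0 hg1,
    lintegral_eq_lintegral_meas_lt_Ioo hh hh0 hh1, ← lintegral_const_mul' _ _ (by simp),
    ← lintegral_const_mul' _ _ (by simp)]
  refine (le_lintegral_add _ _).trans (setLIntegral_mono' measurableSet_Ioo fun t ht => ?_)
  rw [← volume_const_mul_preimage_inv h1s, ← volume_const_mul_preimage_inv hs0]
  obtain ⟨x₁, hx₁⟩ := hf2 t ht.2
  obtain ⟨x₂, hx₂⟩ := hg2 t ht.2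
  refine volume_add_le_of_forall_add_mem
    ((measurable_const_mul _) (measurableSet_lt measurable_const hf))
    ((measurable_const_mul _) (measurableSet_lt measurable_const hg))
    ⟨(1 - s) * x₁, by simpa [h1s.ne'] using hx₁⟩
    ⟨s * x₂, by simpa [hs0.ne'] using hx₂⟩ fun a ha b hb => ?_
  have key := H ((1 - s)⁻¹ * a) (s⁻¹ * b)
  rw [mul_inv_cancel_left₀ h1s.ne', mul_inv_cancel_left₀ hs0.ne'] at key
  refine lt_of_lt_of_le ?_ key
  calc t = t ^ (1 - s) * t ^ s := by rw [← Real.rpow_add ht.1]; simp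
    _ < _ := mul_lt_mul'' (Real.rpow_lt_rpow ht.1.le ha h1s) (Real.rpow_lt_rpow ht.1.le hb hs0)
      (Real.rpow_nonneg ht.1.le _) (Real.rpow_nonneg ht.1.le _)

theorem ENNReal.rpow_mul_rpow_le_add {s : ℝ} (hs0 : 0 < s) (hs1 : s < 1) {a b : ENNReal}
    (ha : a ≠ ⊤) (hb : b ≠ ⊤) :
    a ^ (1 - s) * b ^ s ≤ ENNReal.ofReal (1 - s) * a + ENNReal.ofReal s * b := by
  have h1s : 0 < 1 - s := sub_pos.2 hs1
  lift a to NNReal using ha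
  lift b to NNReal using hb
  rw [← ENNReal.coe_rpow_of_nonneg _ h1s.le, ← ENNReal.coe_rpow_of_nonneg _ hs0.le,
    ENNReal.ofReal, ENNReal.ofReal]
  norm_cast
  have := NNReal.geom_mean_le_arith_mean2_weighted (1 - s).toNNReal s.toNNReal a b
    (by rw [← Real.toNNReal_add h1s.le hs0.le]; simp)
  rwa [Real.coe_toNNReal _ h1s.le, Real.coe_toNNReal _ hs0.le] at this

/-- The one-dimensional Prékopa–Leindler inequality for functions with supremum `1`. -/
theorem lintegral_rpow_mul_le_of_iSup_eq_one {s : ℝ} (hs0 : 0 < s) (hs1 : s < 1)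
    {f g h : ℝ → ENNReal} (hf : Measurable f) (hg : Measurable g) (hh : Measurable h)
    (hf1 : ⨆ x, f x = 1) (hg1 : ⨆ x, g x = 1)
    (H : ∀ x y, f x ^ (1 - s) * g y ^ s ≤ h ((1 - s) * x + s * y)) :
    (∫⁻ x, f x) ^ (1 - s) * (∫⁻ x, g x) ^ s ≤ ∫⁻ x, h x := by
  have h1s : 0 < 1 - s := sub_pos.2 hs1
  have hfle : ∀ x, f x ≤ 1 := fun x => hf1 ▸ le_iSup f x
  have hgle : ∀ x, g x ≤ 1 := fun x => hg1 ▸ le_iSup g x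
  have lt_of_iSup : ∀ {u : ℝ → ENNReal}, (∀ x, u x ≤ 1) → ⨆ x, u x = 1 →
      ∀ t < (1 : ℝ), ∃ x, t < (u x).toReal := by
    intro u hu hu1 t ht
    have : ENNReal.ofReal t < ⨆ x, u x := by
      rw [hu1]; exact ENNReal.ofReal_lt_one.2 ht
    obtain ⟨x, hx⟩ := lt_iSup_iff.1 this
    refine ⟨x, lt_of_not_ge fun h => hx.not_ge ?_⟩
    rw [← ENNReal.ofReal_toReal ((hu x).trans_lt ENNReal.one_lt_top).ne]
    exact ENNReal.ofReal_le_ofReal h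
  have key := lintegral_add_le_of_prekopa_leindler hs0 hs1 (f := fun x => (f x).toReal)
    (g := fun x => (g x).toReal) (h := fun x => (min (h x) 1).toReal)
    hf.ennreal_toReal hg.ennreal_toReal (hh.min measurable_const).ennreal_toReal
    (fun _ => ENNReal.toReal_nonneg) (fun _ => ENNReal.toReal_nonneg)
    (fun _ => ENNReal.toReal_nonneg)
    (fun x => ENNReal.toReal_le_of_le_ofReal zero_le_one (by simpa using hfle x))
    (fun x => ENNReal.toReal_le_of_le_ofReal zero_le_one (by simpa using hgle x))
    (fun x => ENNReal.toReal_le_of_le_ofReal zero_le_one (by simp))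
    (lt_of_iSup hfle hf1) (lt_of_iSup hgle hg1) (fun x y => by
      rw [ENNReal.toReal_rpow, ENNReal.toReal_rpow, ← ENNReal.toReal_mul]
      refine ENNReal.toReal_mono (by simp) (le_min (H x y) ?_)
      exact mul_le_one' (ENNReal.rpow_le_one (hfle x) h1s.le) (ENNReal.rpow_le_one (hgle y) hs0.le))
  have hofReal : ∀ {u : ℝ → ENNReal}, (∀ x, u x ≤ 1) →
      (∫⁻ x, ENNReal.ofReal (u x).toReal) = ∫⁻ x, u x := fun hu =>
    lintegral_congr fun x => ENNReal.ofReal_toReal ((hu x).trans_lt ENNReal.one_lt_top).ne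
  rw [hofReal hfle, hofReal hgle, hofReal fun x => min_le_right _ _] at key
  replace key := key.trans (lintegral_mono fun x => min_le_left (h x) 1)
  by_cases hftop : ∫⁻ x, f x = ⊤
  · rw [hftop, ENNReal.mul_top (by simpa using hs1), top_add, top_le_iff] at key
    rw [key]; exact le_top
  by_cases hgtop : ∫⁻ x, g x = ⊤
  · rw [hgtop, ENNReal.mul_top (by simpa using hs0), add_top, top_le_iff] at key
    rw [key]; exact le_top
  exact (ENNReal.rpow_mul_rpow_le_add hs0 hs1 hftop hgtop).trans key

theorem lintegral_rpow_mul_le_of_iSup_ne_top {s : ℝ} (hs0 : 0 < s) (hs1 : s < 1)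
    {f g h : ℝ → ENNReal} (hf : Measurable f) (hg : Measurable g) (hh : Measurable h)
    (hf1 : ⨆ x, f x ≠ ⊤) (hg1 : ⨆ x, g x ≠ ⊤)
    (H : ∀ x y, f x ^ (1 - s) * g y ^ s ≤ h ((1 - s) * x + s * y)) :
    (∫⁻ x, f x) ^ (1 - s) * (∫⁻ x, g x) ^ s ≤ ∫⁻ x, h x := by
  have h1s : 0 < 1 - s := sub_pos.2 hs1
  by_cases hf0 : ⨆ x, f x = 0
  · have : ∀ x, f x = 0 := by simpa using hf0
    simp [this, ENNReal.zero_rpow_of_pos h1s]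
  by_cases hg0 : ⨆ x, g x = 0
  · have : ∀ x, g x = 0 := by simpa using hg0
    simp [this, ENNReal.zero_rpow_of_pos hs0]
  set F := ⨆ x, f x
  set G := ⨆ x, g x
  have hP0 : F ^ (1 - s) * G ^ s ≠ 0 := by simp [hf0, hf1, hg0, hg1]
  have hPtop : F ^ (1 - s) * G ^ s ≠ ⊤ := by
    exact ENNReal.mul_ne_top (ENNReal.rpow_ne_top_of_nonneg h1s.le hf1)
      (ENNReal.rpow_ne_top_of_nonneg hs0.le hg1)
  have hinv : (F ^ (1 - s) * G ^ s)⁻¹ = F⁻¹ ^ (1 - s) * G⁻¹ ^ s := by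
    rw [ENNReal.mul_inv (by simp [hf0, hf1]) (by simp [hf0, hf1]), ENNReal.inv_rpow,
      ENNReal.inv_rpow]
  have key := lintegral_rpow_mul_le_of_iSup_eq_one hs0 hs1 (f := fun x => F⁻¹ * f x)
    (g := fun x => G⁻¹ * g x) (h := fun x => (F ^ (1 - s) * G ^ s)⁻¹ * h x)
    (hf.const_mul _) (hg.const_mul _) (hh.const_mul _)
    (by rw [← ENNReal.mul_iSup, ENNReal.inv_mul_cancel hf0 hf1])
    (by rw [← ENNReal.mul_iSup, ENNReal.inv_mul_cancel hg0 hg1]) (fun x y => by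
      rw [ENNReal.mul_rpow_of_nonneg _ _ h1s.le, ENNReal.mul_rpow_of_nonneg _ _ hs0.le, hinv,
        mul_mul_mul_comm]
      gcongr
      exact H x y)
  rw [lintegral_const_mul _ hf, lintegral_const_mul _ hg, lintegral_const_mul _ hh,
    ENNReal.mul_rpow_of_nonneg _ _ h1s.le, ENNReal.mul_rpow_of_nonneg _ _ hs0.le,
    mul_mul_mul_comm, ← hinv] at key
  exact (ENNReal.mul_le_mul_iff_right (ENNReal.inv_ne_zero.2 hPtop)
    (ENNReal.inv_ne_top.2 hP0)).1 key

theorem lintegral_eq_iSup_lintegral_min {f : ℝ → ENNReal} (hf : Measurable f) :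
    ∫⁻ x, f x = ⨆ n : ℕ, ∫⁻ x, min (f x) n := by
  rw [← lintegral_iSup (fun n => hf.min measurable_const)
    (fun n k hnk x => min_le_min le_rfl (by exact_mod_cast hnk))]
  refine lintegral_congr fun x => ?_
  rw [← inf_iSup_eq, ENNReal.iSup_natCast, inf_top_eq]

/-- The one-dimensional Prékopa–Leindler inequality. -/
theorem lintegral_rpow_mul_lintegral_rpow_le {s : ℝ} (hs0 : 0 < s) (hs1 : s < 1)
    {f g h : ℝ → ENNReal} (hf : Measurable f) (hg : Measurable g) (hh : Measurable h)
    (H : ∀ x y, f x ^ (1 - s) * g y ^ s ≤ h ((1 - s) * x + s * y)) :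
    (∫⁻ x, f x) ^ (1 - s) * (∫⁻ x, g x) ^ s ≤ ∫⁻ x, h x := by
  have h1s : 0 < 1 - s := sub_pos.2 hs1
  have hsup : ∀ {p : ℝ}, 0 < p → ∀ u : ℕ → ENNReal, (⨆ n, u n) ^ p = ⨆ n, u n ^ p :=
    fun hp u => (ENNReal.orderIsoRpow _ hp).map_iSup u
  rw [lintegral_eq_iSup_lintegral_min hf, lintegral_eq_iSup_lintegral_min hg, hsup h1s, hsup hs0,
    ENNReal.iSup_mul]
  refine iSup_le fun n => ?_
  rw [ENNReal.mul_iSup]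
  refine iSup_le fun k => ?_
  refine lintegral_rpow_mul_le_of_iSup_ne_top hs0 hs1 (hf.min measurable_const)
    (hg.min measurable_const) hh
    (ne_top_of_le_ne_top (ENNReal.natCast_ne_top n) (iSup_le fun x => min_le_right _ _))
    (ne_top_of_le_ne_top (ENNReal.natCast_ne_top k) (iSup_le fun x => min_le_right _ _))
    fun x y => le_trans ?_ (H x y)
  gcongr
  · exact min_le_left _ _
  · exact min_le_left _ _

instance isProbabilityMeasure_stdGaussianPi (n : ℕ) : IsProbabilityMeasure (stdGaussianPi n) := by
  unfold stdGaussianPi; infer_instance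

theorem gaussianPDF_rpow_mul_rpow (s x y : ℝ) :
    gaussianPDF 0 1 x ^ (1 - s) * gaussianPDF 0 1 y ^ s *
      ENNReal.ofReal (Real.exp (s * (1 - s) / 2 * (x - y) ^ 2)) =
        gaussianPDF 0 1 ((1 - s) * x + s * y) := by
  have hc : 0 < (√(2 * π))⁻¹ := by positivity
  simp only [gaussianPDF]
  rw [ENNReal.ofReal_rpow_of_pos (gaussianPDFReal_pos _ _ _ one_ne_zero),
    ENNReal.ofReal_rpow_of_pos (gaussianPDFReal_pos _ _ _ one_ne_zero),
    ← ENNReal.ofReal_mul (Real.rpow_nonneg (gaussianPDFReal_nonneg _ _ _) _),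
    ← ENNReal.ofReal_mul (mul_nonneg (Real.rpow_nonneg (gaussianPDFReal_nonneg _ _ _) _)
      (Real.rpow_nonneg (gaussianPDFReal_nonneg _ _ _) _))]
  congr 1
  simp only [gaussianPDFReal, NNReal.coe_one, mul_one, sub_zero]
  rw [Real.mul_rpow hc.le (by positivity), Real.mul_rpow hc.le (by positivity), ← Real.exp_mul,
    ← Real.exp_mul]
  calc _ = ((√(2 * π))⁻¹ ^ (1 - s) * (√(2 * π))⁻¹ ^ s) * (rexp (-x ^ 2 / 2 * (1 - s)) *
        rexp (-y ^ 2 / 2 * s) * rexp (s * (1 - s) / 2 * (x - y) ^ 2)) := by ring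
    _ = _ := by
      rw [← Real.rpow_add hc, ← Real.exp_add, ← Real.exp_add, sub_add_cancel, Real.rpow_one]
      congr 2
      ring

/-- The Prékopa–Leindler inequality relative to the standard Gaussian measure on `ℝ`. -/
theorem lintegral_gaussianReal_rpow_mul_le {s : ℝ} (hs0 : 0 < s) (hs1 : s < 1)
    {f g h : ℝ → ENNReal} (hf : Measurable f) (hg : Measurable g) (hh : Measurable h)
    (H : ∀ x y, f x ^ (1 - s) * g y ^ s ≤
      ENNReal.ofReal (Real.exp (s * (1 - s) / 2 * (x - y) ^ 2)) * h ((1 - s) * x + s * y)) :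
    (∫⁻ x, f x ∂gaussianReal 0 1) ^ (1 - s) * (∫⁻ x, g x ∂gaussianReal 0 1) ^ s ≤
      ∫⁻ x, h x ∂gaussianReal 0 1 := by
  have h1s : 0 < 1 - s := sub_pos.2 hs1
  have hp := measurable_gaussianPDF 0 1
  simp only [gaussianReal_of_var_ne_zero 0 one_ne_zero,
    lintegral_withDensity_eq_lintegral_mul _ hp hf,
    lintegral_withDensity_eq_lintegral_mul _ hp hg, lintegral_withDensity_eq_lintegral_mul _ hp hh]
  refine lintegral_rpow_mul_lintegral_rpow_le hs0 hs1 (hp.mul hf) (hp.mul hg) (hp.mul hh)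
    fun x y => ?_
  simp only [Pi.mul_apply]
  rw [ENNReal.mul_rpow_of_nonneg _ _ h1s.le, ENNReal.mul_rpow_of_nonneg _ _ hs0.le,
    mul_mul_mul_comm, ← gaussianPDF_rpow_mul_rpow, mul_assoc (_ * _)]
  exact mul_le_mul_right (H x y) _

theorem measurable_finCons (n : ℕ) :
    Measurable fun p : ℝ × (Fin n → ℝ) => (Fin.cons p.1 p.2 : Fin (n + 1) → ℝ) := by
  refine measurable_pi_iff.2 (Fin.cases ?_ fun i => ?_)
  · simpa using measurable_fst
  · simpa using measurable_snd.eval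

theorem lintegral_stdGaussianPi_succ {n : ℕ} {f : (Fin (n + 1) → ℝ) → ENNReal}
    (hf : Measurable f) :
    ∫⁻ x, f x ∂stdGaussianPi (n + 1) =
      ∫⁻ a, ∫⁻ z, f (Fin.cons a z) ∂stdGaussianPi n ∂gaussianReal 0 1 := by
  have hmp := (measurePreserving_piFinSuccAbove
    (fun _ : Fin (n + 1) => gaussianReal 0 1) 0).symm
  rw [stdGaussianPi, ← hmp.lintegral_comp hf, lintegral_prod]
  · simp [stdGaussianPi, MeasurableEquiv.piFinSuccAbove, Fin.consEquiv]
  · exact (hf.comp (MeasurableEquiv.measurable _)).aemeasurable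

/-- The Prékopa–Leindler inequality relative to the standard Gaussian measure on `ℝⁿ`. -/
theorem lintegral_stdGaussianPi_rpow_mul_le {s : ℝ} (hs0 : 0 < s) (hs1 : s < 1) (n : ℕ)
    {f g h : (Fin n → ℝ) → ENNReal} (hf : Measurable f) (hg : Measurable g) (hh : Measurable h)
    (H : ∀ x y, f x ^ (1 - s) * g y ^ s ≤
      ENNReal.ofReal (Real.exp (s * (1 - s) / 2 * ∑ i, (x i - y i) ^ 2)) *
        h (fun i => (1 - s) * x i + s * y i)) :
    (∫⁻ x, f x ∂stdGaussianPi n) ^ (1 - s) * (∫⁻ x, g x ∂stdGaussianPi n) ^ s ≤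
      ∫⁻ x, h x ∂stdGaussianPi n := by
  induction n with
  | zero =>
    have hdirac : stdGaussianPi 0 = Measure.dirac isEmptyElim :=
      Measure.pi_of_empty (fun _ : Fin 0 => gaussianReal 0 1) isEmptyElim
    rw [hdirac, lintegral_dirac' _ hf, lintegral_dirac' _ hg, lintegral_dirac' _ hh]
    have hz : (fun i : Fin 0 => (1 - s) * (isEmptyElim i : ℝ) + s * isEmptyElim i) =
      isEmptyElim := Subsingleton.elim _ _
    simpa [hz] using H isEmptyElim isEmptyElim
  | succ n ih =>
    have hcons := measurable_finCons n
    have hcons' : ∀ a : ℝ, Measurable fun z : Fin n → ℝ => (Fin.cons a z : Fin (n + 1) → ℝ) :=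
      fun a => hcons.comp (measurable_const.prodMk measurable_id)
    rw [lintegral_stdGaussianPi_succ hf, lintegral_stdGaussianPi_succ hg,
      lintegral_stdGaussianPi_succ hh]
    refine lintegral_gaussianReal_rpow_mul_le hs0 hs1 (hf.comp hcons).lintegral_prod_right'
      (hg.comp hcons).lintegral_prod_right' (hh.comp hcons).lintegral_prod_right' fun a b => ?_
    have hhm : Measurable fun z => h (Fin.cons ((1 - s) * a + s * b) z) := hh.comp (hcons' _)
    rw [← lintegral_const_mul _ hhm]
    refine ih (hf.comp (hcons' a)) (hg.comp (hcons' b)) (hhm.const_mul _)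
      fun x y => ?_
    refine (H _ _).trans (le_of_eq ?_)
    rw [← mul_assoc, ← ENNReal.ofReal_mul (Real.exp_pos _).le, ← Real.exp_add, Fin.sum_univ_succ]
    congr 3
    · simp; ring
    · ext i
      refine Fin.cases ?_ (fun i => ?_) i <;> simp

theorem integrable_exp_neg_mul {Ω : Type*} [MeasurableSpace Ω] (μ : Measure Ω)
    [IsFiniteMeasure μ] {f : Ω → ℝ} (hf : Measurable f) (hf0 : ∀ x, 0 ≤ f x) {θ : ℝ}
    (hθ : 0 ≤ θ) : Integrable (fun x => Real.exp (-θ * f x)) μ := by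
  refine Integrable.of_bound (by fun_prop) 1 (Filter.Eventually.of_forall fun x => ?_)
  rw [Real.norm_of_nonneg (Real.exp_pos _).le, Real.exp_le_one_iff]
  nlinarith [mul_nonneg hθ (hf0 x)]

theorem Real.exp_neg_le_one_sub_add_sq {u : ℝ} (hu : 0 ≤ u) :
    Real.exp (-u) ≤ 1 - u + u ^ 2 / 2 := by
  have h := Real.quadratic_le_exp_of_nonneg hu
  rw [Real.exp_neg]
  refine inv_le_of_inv_le₀ (by nlinarith [sq_nonneg (u - 1)]) (le_trans ?_ h)
  rw [inv_le_iff_one_le_mul₀ (by nlinarith [sq_nonneg (u - 1)])]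
  nlinarith [sq_nonneg (u ^ 2)]

/-- A nonnegative random variable with two moments has Laplace transform bounded by the second
order expansion of its exponent. -/
theorem integral_exp_neg_mul_le {Ω : Type*} [MeasurableSpace Ω] (μ : Measure Ω)
    [IsProbabilityMeasure μ] {f : Ω → ℝ} (hf : Measurable f) (hf0 : ∀ x, 0 ≤ f x)
    (hf1 : Integrable f μ) (hf2 : Integrable (fun x => f x ^ 2) μ) {θ : ℝ} (hθ : 0 ≤ θ) :
    ∫ x, Real.exp (-θ * f x) ∂μ ≤
      Real.exp (-θ * (∫ x, f x ∂μ) + θ ^ 2 / 2 * ∫ x, f x ^ 2 ∂μ) := by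
  have hlin₁ : Integrable (fun x => 1 - θ * f x) μ := (integrable_const 1).sub (hf1.const_mul θ)
  have hquad : Integrable (fun x => 1 - θ * f x + θ ^ 2 / 2 * f x ^ 2) μ :=
    hlin₁.add (hf2.const_mul _)
  calc ∫ x, Real.exp (-θ * f x) ∂μ ≤ ∫ x, (1 - θ * f x + θ ^ 2 / 2 * f x ^ 2) ∂μ := by
        refine integral_mono (integrable_exp_neg_mul μ hf hf0 hθ) hquad fun x => ?_
        have := Real.exp_neg_le_one_sub_add_sq (mul_nonneg hθ (hf0 x))
        rw [← neg_mul] at this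
        refine this.trans_eq ?_
        ring
    _ = (-θ * (∫ x, f x ∂μ) + θ ^ 2 / 2 * ∫ x, f x ^ 2 ∂μ) + 1 := by
        rw [integral_add hlin₁ (hf2.const_mul _),
          integral_sub (integrable_const 1) (hf1.const_mul θ), integral_const_mul,
          integral_const_mul]
        simp
        ring
    _ ≤ _ := Real.add_one_le_exp _

/-- The sharp Gaussian lower concentration inequality for Lipschitz functions, in Laplace
transform form. -/
theorem integral_exp_neg_mul_le_of_lipschitz {n : ℕ} {f : (Fin n → ℝ) → ℝ} (hf : Measurable f)
    (hf0 : ∀ x, 0 ≤ f x) (hLip : ∀ y z, f z ≤ f y + √(∑ i, (z i - y i) ^ 2))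
    (hf1 : Integrable f (stdGaussianPi n)) (hf2 : Integrable (fun x => f x ^ 2) (stdGaussianPi n))
    {θ : ℝ} (hθ : 0 ≤ θ) :
    ∫ x, Real.exp (-θ * f x) ∂stdGaussianPi n ≤
      Real.exp (θ ^ 2 / 2 - θ * ∫ x, f x ∂stdGaussianPi n) := by
  set E := ∫ x, f x ∂stdGaussianPi n
  set V := ∫ x, f x ^ 2 ∂stdGaussianPi n
  set Z := fun θ : ℝ => ∫ x, Real.exp (-θ * f x) ∂stdGaussianPi n with hZ
  have hZ0 : ∀ θ, 0 ≤ Z θ := fun θ => integral_nonneg fun x => (Real.exp_pos _).le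
  have hlin : ∀ c θ : ℝ, 0 ≤ θ → ∫⁻ x, ENNReal.ofReal (Real.exp (-θ * f x + c)) ∂stdGaussianPi n =
      ENNReal.ofReal (Real.exp c * Z θ) := by
    intro c θ hθ
    rw [hZ, ← integral_const_mul, ofReal_integral_eq_lintegral_ofReal
      ((integrable_exp_neg_mul _ hf hf0 hθ).const_mul _)
      (Filter.Eventually.of_forall fun x => by positivity)]
    simp only [← Real.exp_add, add_comm]
  have main : ∀ s : ℝ, 0 < s → s < 1 →
      Z θ ≤ Real.exp (θ ^ 2 / 2 - θ * E + s * (θ ^ 2 / 2 * V - θ ^ 2 / 2)) := by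
    intro s hs0 hs1
    have h1s : 0 < 1 - s := sub_pos.2 hs1
    have pl := lintegral_stdGaussianPi_rpow_mul_le hs0 hs1 n (f := fun _ => 1)
      (g := fun y => ENNReal.ofReal (Real.exp (-θ * f y + (-θ ^ 2 / 2))))
      (h := fun z => ENNReal.ofReal (Real.exp (-(s * θ) * f z + (-(s * θ) ^ 2 / 2))))
      measurable_const (by fun_prop) (by fun_prop) (fun x y => by
        rw [ENNReal.one_rpow, one_mul, ENNReal.ofReal_rpow_of_pos (Real.exp_pos _),
          ← ENNReal.ofReal_mul (Real.exp_pos _).le, ← Real.exp_mul, ← Real.exp_add]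
        refine ENNReal.ofReal_le_ofReal (Real.exp_le_exp.2 ?_)
        have h1 := hLip y (fun i => (1 - s) * x i + s * y i)
        have h2 : ∑ i, ((1 - s) * x i + s * y i - y i) ^ 2 =
            (1 - s) ^ 2 * ∑ i, (x i - y i) ^ 2 := by
          rw [Finset.mul_sum]
          exact Finset.sum_congr rfl fun i _ => by ring
        rw [h2, Real.sqrt_mul (sq_nonneg _), Real.sqrt_sq h1s.le] at h1
        have h3 := Real.sq_sqrt (Finset.sum_nonneg fun i (_ : i ∈ Finset.univ) =>
          sq_nonneg (x i - y i))
        rw [← h3]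
        set D := √(∑ i, (x i - y i) ^ 2)
        have h4 := mul_le_mul_of_nonneg_left h1 (mul_nonneg hs0.le hθ)
        nlinarith [mul_nonneg (mul_nonneg hs0.le h1s.le) (sq_nonneg (D - θ))])
    rw [lintegral_one, measure_univ, ENNReal.one_rpow, one_mul, hlin _ _ hθ,
      hlin _ _ (mul_nonneg hs0.le hθ), ENNReal.ofReal_rpow_of_nonneg (mul_nonneg (Real.exp_pos _).le
      (hZ0 _)) hs0.le, ENNReal.ofReal_le_ofReal_iff (mul_nonneg (Real.exp_pos _).le (hZ0 _))] at pl
    have h5 := integral_exp_neg_mul_le _ hf hf0 hf1 hf2 (mul_nonneg hs0.le hθ)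
    have h6 : (Real.exp (-θ ^ 2 / 2) * Z θ) ^ s ≤
        Real.exp (-θ ^ 2 / 2 + (θ ^ 2 / 2 - θ * E + s * (θ ^ 2 / 2 * V - θ ^ 2 / 2))) ^ s := by
      refine pl.trans ((mul_le_mul_of_nonneg_left h5 (Real.exp_pos _).le).trans_eq ?_)
      rw [← Real.exp_add, ← Real.exp_mul]
      congr 1
      ring
    rw [Real.rpow_le_rpow_iff (mul_nonneg (Real.exp_pos _).le (hZ0 _)) (Real.exp_pos _).le hs0,
      Real.exp_add] at h6
    exact le_of_mul_le_mul_left h6 (Real.exp_pos _)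
  have hlim : Filter.Tendsto
      (fun s : ℝ => Real.exp (θ ^ 2 / 2 - θ * E + s * (θ ^ 2 / 2 * V - θ ^ 2 / 2)))
      (nhdsWithin 0 (Set.Ioi 0)) (nhds (Real.exp (θ ^ 2 / 2 - θ * E))) := by
    have : Continuous fun s : ℝ =>
        Real.exp (θ ^ 2 / 2 - θ * E + s * (θ ^ 2 / 2 * V - θ ^ 2 / 2)) := by
      fun_prop
    simpa using (this.tendsto 0).mono_left nhdsWithin_le_nhds
  refine ge_of_tendsto hlim ?_
  filter_upwards [Ioo_mem_nhdsGT (zero_lt_one' ℝ)] with s hs using main s hs.1 hs.2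

theorem lintegral_gaussianReal_tilt {σ ν : ℝ} (hσ : 0 < σ) (hν : σ ^ 2 * (1 - ν) = 1)
    {F : ℝ → ENNReal} (hF : Measurable F) :
    ∫⁻ x, ENNReal.ofReal (Real.exp (ν / 2 * x ^ 2)) * F x ∂gaussianReal 0 1 =
      ENNReal.ofReal σ * ∫⁻ x, F (σ * x) ∂gaussianReal 0 1 := by
  have hmap : (gaussianReal 0 1).map (σ * ·) = gaussianReal 0 (.mk (σ ^ 2) (sq_nonneg σ)) := by
    rw [gaussianReal_map_const_mul]; simp
  have hv : NNReal.mk (σ ^ 2) (sq_nonneg σ) ≠ 0 := by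
    simpa [← NNReal.coe_eq_zero] using hσ.ne'
  rw [← lintegral_map hF (measurable_const_mul σ), hmap, gaussianReal_of_var_ne_zero 0 one_ne_zero,
    gaussianReal_of_var_ne_zero 0 hv,
    lintegral_withDensity_eq_lintegral_mul _ (measurable_gaussianPDF _ _) hF,
    lintegral_withDensity_eq_lintegral_mul _ (measurable_gaussianPDF _ _) (by fun_prop),
    ← lintegral_const_mul' _ _ (by simp)]
  refine lintegral_congr fun x => ?_
  simp only [Pi.mul_apply, gaussianPDF]
  rw [← mul_assoc, ← mul_assoc, ← ENNReal.ofReal_mul (gaussianPDFReal_nonneg _ _ _),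
    ← ENNReal.ofReal_mul hσ.le]
  congr 2
  simp only [gaussianPDFReal, NNReal.coe_one, NNReal.coe_mk, mul_one, sub_zero]
  rw [mul_comm (2 * π), Real.sqrt_mul (sq_nonneg σ), Real.sqrt_sq hσ.le, mul_inv, ← mul_assoc,
    mul_inv_cancel_left₀ hσ.ne', mul_assoc, ← Real.exp_add]
  congr 2
  field_simp
  linear_combination (-x ^ 2) * hν

theorem lintegral_stdGaussianPi_tilt {σ ν : ℝ} (hσ : 0 < σ) (hν : σ ^ 2 * (1 - ν) = 1) (n : ℕ)
    {F : (Fin n → ℝ) → ENNReal} (hF : Measurable F) :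
    ∫⁻ x, ENNReal.ofReal (Real.exp (ν / 2 * ∑ i, x i ^ 2)) * F x ∂stdGaussianPi n =
      ENNReal.ofReal σ ^ n * ∫⁻ x, F (fun i => σ * x i) ∂stdGaussianPi n := by
  induction n with
  | zero =>
    simp only [Finset.univ_eq_empty, Finset.sum_empty, mul_zero, Real.exp_zero,
      ENNReal.ofReal_one, one_mul, pow_zero]
    exact lintegral_congr fun x => congrArg F (Subsingleton.elim _ _)
  | succ n ih =>
    have hcons := measurable_finCons n
    have hcons' : ∀ a : ℝ, Measurable fun z : Fin n → ℝ => (Fin.cons a z : Fin (n + 1) → ℝ) :=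
      fun a => hcons.comp (measurable_const.prodMk measurable_id)
    have hscale : Measurable fun (z : Fin n → ℝ) i => σ * z i := by fun_prop
    have hG : Measurable fun a => ∫⁻ z, F (Fin.cons a fun i => σ * z i) ∂stdGaussianPi n :=
      (hF.comp (hcons.comp (measurable_fst.prodMk
        (hscale.comp measurable_snd)))).lintegral_prod_right'
    have h1 : ∀ (a : ℝ) (z : Fin n → ℝ), (fun i => σ * (Fin.cons a z : Fin (n + 1) → ℝ) i) =
        (Fin.cons (σ * a) fun i => σ * z i : Fin (n + 1) → ℝ) := by
      intro a z
      ext i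
      refine Fin.cases ?_ (fun i => ?_) i <;> simp
    rw [lintegral_stdGaussianPi_succ (by fun_prop), lintegral_stdGaussianPi_succ (by fun_prop)]
    simp only [h1, Fin.sum_univ_succ, Fin.cons_zero, Fin.cons_succ, mul_add, Real.exp_add,
      ENNReal.ofReal_mul (Real.exp_pos _).le, mul_assoc]
    rw [pow_succ, mul_assoc, ← lintegral_gaussianReal_tilt hσ hν hG,
      ← lintegral_const_mul' _ _ (by simp)]
    refine lintegral_congr fun a => ?_
    rw [lintegral_const_mul' _ _ (by simp),
      ih (F := fun z => F (Fin.cons a z)) (hF.comp (hcons' a)),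
      mul_left_comm]

theorem map_sum_mul_pi_gaussianReal {n : ℕ} {x : Fin n → ℝ} (hx : ∑ j, x j ^ 2 = 1) :
    (Measure.pi fun _ : Fin n => gaussianReal 0 1).map (fun a => ∑ j, a j * x j) =
      gaussianReal 0 1 := by
  have hlaw : ∀ j, (Measure.pi fun _ : Fin n => gaussianReal 0 1).map
      (fun a => a j * x j) = gaussianReal 0 (.mk (x j ^ 2) (sq_nonneg _)) := by
    intro j
    have hcomp : (fun a : Fin n → ℝ => a j * x j) = (fun t => t * x j) ∘ fun a => a j := rfl
    rw [hcomp, ← Measure.map_map (g := fun t => t * x j) (f := fun a : Fin n → ℝ => a j)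
      (by fun_prop) (by fun_prop),
      (measurePreserving_eval (fun _ : Fin n => gaussianReal 0 1) j).map_eq,
      gaussianReal_map_mul_const]
    simp
  have hind : iIndepFun (fun j (a : Fin n → ℝ) => a j * x j)
      (Measure.pi fun _ : Fin n => gaussianReal 0 1) :=
    iIndepFun_pi (X := fun j (t : ℝ) => t * x j) fun j => by fun_prop
  refine Measure.ext_of_charFun ?_
  ext t
  rw [hind.charFun_map_fun_sum_eq_prod fun j =>
    ((measurable_pi_apply j).mul_const _).aemeasurable]
  simp only [hlaw, Finset.prod_apply, charFun_gaussianReal]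
  rw [← Complex.exp_sum]
  congr 1
  simp only [Complex.ofReal_zero, mul_zero, zero_mul, zero_sub, NNReal.coe_mk, NNReal.coe_one]
  rw [Finset.sum_neg_distrib, ← Finset.sum_div, ← Finset.sum_mul]
  simp [← Complex.ofReal_pow, ← Complex.ofReal_sum, hx]

/-- The image of a fixed unit vector under a Gaussian matrix is a standard Gaussian vector. -/
theorem map_gaussianMatrix {m n : ℕ} {x : Fin n → ℝ} (hx : ∑ j, x j ^ 2 = 1) :
    (gaussianMatrix m n).map (fun A i => ∑ j, A i j * x j) = stdGaussianPi m := by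
  have hm : Measurable fun a : Fin n → ℝ => ∑ j, a j * x j := by fun_prop
  have : IsProbabilityMeasure
      ((Measure.pi fun _ : Fin n => gaussianReal 0 1).map fun a => ∑ j, a j * x j) :=
    Measure.isProbabilityMeasure_map hm.aemeasurable
  have hpi := Measure.pi_map_pi (μ := fun _ : Fin m => Measure.pi fun _ : Fin n => gaussianReal 0 1)
    (f := fun _ a => ∑ j, a j * x j) fun _ => hm.aemeasurable
  simp only [map_sum_mul_pi_gaussianReal hx] at hpi
  exact hpi

/-- The Euclidean norm of the `k` entries of `y` that are largest in absolute value. -/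
noncomputable def topNorm {m : ℕ} (k : ℕ) (y : Fin m → ℝ) : ℝ :=
  ⨆ T : {T : Finset (Fin m) // T.card = k}, √(∑ i ∈ T.1, y i ^ 2)

section TopNorm

variable {m k : ℕ}

theorem topNorm_nonneg (y : Fin m → ℝ) : 0 ≤ topNorm k y :=
  Real.iSup_nonneg fun _ => Real.sqrt_nonneg _

theorem le_topNorm (y : Fin m → ℝ) {T : Finset (Fin m)} (hT : T.card = k) :
    √(∑ i ∈ T, y i ^ 2) ≤ topNorm k y :=
  le_ciSup (f := fun T : {T : Finset (Fin m) // T.card = k} => √(∑ i ∈ T.1, y i ^ 2))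
    (Set.finite_range _).bddAbove ⟨T, hT⟩

theorem topNorm_le {y : Fin m → ℝ} {c : ℝ} (hc : 0 ≤ c)
    (h : ∀ T : Finset (Fin m), T.card = k → √(∑ i ∈ T, y i ^ 2) ≤ c) : topNorm k y ≤ c :=
  Real.iSup_le (fun T => h T.1 T.2) hc

theorem measurable_topNorm : Measurable (topNorm k : (Fin m → ℝ) → ℝ) := by
  refine Measurable.iSup fun T => ?_
  fun_prop

theorem topNorm_le_sqrt (y : Fin m → ℝ) : topNorm k y ≤ √(∑ i, y i ^ 2) :=
  topNorm_le (Real.sqrt_nonneg _) fun _ _ => Real.sqrt_le_sqrt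
    (Finset.sum_le_univ_sum_of_nonneg fun _ => sq_nonneg _)

theorem topNorm_const_mul {σ : ℝ} (hσ : 0 ≤ σ) (y : Fin m → ℝ) :
    topNorm k (fun i => σ * y i) = σ * topNorm k y := by
  rw [topNorm, topNorm, Real.mul_iSup_of_nonneg hσ]
  congr 1
  ext T
  simp only [mul_pow]
  rw [← Finset.mul_sum, Real.sqrt_mul (sq_nonneg σ), Real.sqrt_sq hσ]

theorem sqrt_sum_sq_le_add {ι : Type*} (T : Finset ι) (y z : ι → ℝ) :
    √(∑ i ∈ T, z i ^ 2) ≤ √(∑ i ∈ T, y i ^ 2) + √(∑ i ∈ T, (z i - y i) ^ 2) := by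
  have hcs := Real.sum_mul_le_sqrt_mul_sqrt T y fun i => z i - y i
  have hy := Real.sq_sqrt (Finset.sum_nonneg fun i (_ : i ∈ T) => sq_nonneg (y i))
  have hd := Real.sq_sqrt (Finset.sum_nonneg fun i (_ : i ∈ T) => sq_nonneg (z i - y i))
  refine Real.sqrt_le_iff.2 ⟨by positivity, ?_⟩
  have hz : ∑ i ∈ T, z i ^ 2 =
      ∑ i ∈ T, y i ^ 2 + 2 * ∑ i ∈ T, y i * (z i - y i) + ∑ i ∈ T, (z i - y i) ^ 2 := by
    rw [Finset.mul_sum, ← Finset.sum_add_distrib, ← Finset.sum_add_distrib]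
    exact Finset.sum_congr rfl fun i _ => by ring
  rw [hz]
  nlinarith

theorem topNorm_le_add (y z : Fin m → ℝ) :
    topNorm k z ≤ topNorm k y + √(∑ i, (z i - y i) ^ 2) := by
  refine topNorm_le (add_nonneg (topNorm_nonneg y) (Real.sqrt_nonneg _)) fun T hT => ?_
  refine (sqrt_sum_sq_le_add T y z).trans (add_le_add (le_topNorm y hT) (Real.sqrt_le_sqrt ?_))
  exact Finset.sum_le_univ_sum_of_nonneg fun i => sq_nonneg _

theorem sqrt_mul_absOrd_le_topNorm (y : Fin m → ℝ) (j : Fin m) (hj : (j : ℕ) + 1 = k) :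
    √k * absOrd y j ≤ topNorm k y := by
  have hcard : ((Finset.Iic j).map (Tuple.sort fun i => -|y i|).toEmbedding).card = k := by
    rw [Finset.card_map, Fin.card_Iic, hj]
  refine le_trans ?_ (le_topNorm y hcard)
  rw [absOrd, ← Real.sqrt_sq (abs_nonneg (y _)), ← Real.sqrt_mul (Nat.cast_nonneg k)]
  refine Real.sqrt_le_sqrt ?_
  rw [← hcard, Finset.card_map, Finset.sum_map, ← nsmul_eq_mul]
  refine Finset.card_nsmul_le_sum _ _ _ fun i hi => ?_
  have := Tuple.monotone_sort (fun i => -|y i|) (Finset.mem_Iic.1 hi)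
  simp only [Function.comp_apply, neg_le_neg_iff] at this
  rw [Equiv.coe_toEmbedding, ← sq_abs (y (Tuple.sort (fun i => -|y i|) i))]
  gcongr

theorem integrable_sq_eval_stdGaussianPi (i : Fin m) :
    Integrable (fun y : Fin m → ℝ => y i ^ 2) (stdGaussianPi m) :=
  ((measurePreserving_eval (fun _ : Fin m => gaussianReal 0 1) i).integrable_comp
    (g := fun t : ℝ => t ^ 2) (by fun_prop)).2 (memLp_id_gaussianReal 2).integrable_sq

theorem integral_sum_sq_stdGaussianPi : ∫ y, ∑ i, y i ^ 2 ∂stdGaussianPi m = m := by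
  have h1 : ∫ t : ℝ, t ^ 2 ∂gaussianReal 0 1 = 1 := by
    have := variance_eq_integral (μ := gaussianReal 0 1) (X := fun t : ℝ => t) (by fun_prop)
    simpa using this.symm
  rw [integral_finsetSum _ fun i _ => integrable_sq_eval_stdGaussianPi i]
  have h2 : ∀ i : Fin m, ∫ y, y i ^ 2 ∂stdGaussianPi m = 1 := fun i => by
    have hmp := measurePreserving_eval (fun _ : Fin m => gaussianReal 0 1) i
    rw [← h1, ← hmp.map_eq, integral_map hmp.aemeasurable (by fun_prop), stdGaussianPi]
  simp [h2]

theorem topNorm_sq_le (y : Fin m → ℝ) : topNorm k y ^ 2 ≤ ∑ i, y i ^ 2 :=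
  (Real.le_sqrt (topNorm_nonneg y) (by positivity)).1 (topNorm_le_sqrt y)

theorem integrable_topNorm_sq :
    Integrable (fun y => topNorm k y ^ 2) (stdGaussianPi m) := by
  refine (integrable_finsetSum Finset.univ fun i _ => integrable_sq_eval_stdGaussianPi i).mono'
    (measurable_topNorm.pow_const 2).aestronglyMeasurable
    (Filter.Eventually.of_forall fun y => ?_)
  rw [Real.norm_of_nonneg (sq_nonneg _)]
  exact topNorm_sq_le y

theorem integrable_topNorm : Integrable (topNorm k) (stdGaussianPi m) := by
  refine (integrable_topNorm_sq (k := k).add (integrable_const 1)).mono'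
    measurable_topNorm.aestronglyMeasurable (Filter.Eventually.of_forall fun y => ?_)
  rw [Real.norm_of_nonneg (topNorm_nonneg y)]
  simp only [Pi.add_apply]
  nlinarith [sq_nonneg (topNorm k y - 1)]

theorem integral_topNorm_le : ∫ y, topNorm k y ∂stdGaussianPi m ≤ √m := by
  refine Real.le_sqrt_of_sq_le ?_
  have hvar := variance_nonneg (topNorm k) (stdGaussianPi m)
  rw [variance_eq_sub ((memLp_two_iff_integrable_sq
    measurable_topNorm.aestronglyMeasurable).2 integrable_topNorm_sq)] at hvar
  have hle : ∫ y, topNorm k y ^ 2 ∂stdGaussianPi m ≤ m := by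
    rw [← integral_sum_sq_stdGaussianPi]
    exact integral_mono integrable_topNorm_sq
      (integrable_finsetSum _ fun i _ => integrable_sq_eval_stdGaussianPi i) topNorm_sq_le
  simp only [Pi.pow_apply] at hvar
  linarith

theorem integral_exp_neg_topNorm_le {θ : ℝ} (hθ : 0 ≤ θ) :
    ∫ y, Real.exp (-θ * topNorm k y) ∂stdGaussianPi m ≤
      Real.exp (θ ^ 2 / 2 - θ * ∫ y, topNorm k y ∂stdGaussianPi m) :=
  integral_exp_neg_mul_le_of_lipschitz measurable_topNorm topNorm_nonneg topNorm_le_add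
    integrable_topNorm integrable_topNorm_sq hθ

theorem cgProperty.mul_sqrt_log_le_integral_topNorm {c : ℝ} (hc : cgProperty c) (hk : 0 < k)
    (hkm : 2 * k ≤ m) :
    √k * (c * √(Real.log (2 * m / k))) ≤ ∫ y, topNorm k y ∂stdGaussianPi m := by
  obtain ⟨j, rfl⟩ := Nat.exists_eq_succ_of_ne_zero hk.ne'
  let i : Fin m := ⟨j, by omega⟩
  have h1 := hc m i hkm
  calc _ ≤ √(j + 1 : ℕ) * ∫ y, absOrd y i ∂stdGaussianPi m := by
        refine mul_le_mul_of_nonneg_left ?_ (Real.sqrt_nonneg _)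
        simpa [i] using h1
    _ = ∫ y, √(j + 1 : ℕ) * absOrd y i ∂stdGaussianPi m := (integral_const_mul _ _).symm
    _ ≤ _ := integral_mono_of_nonneg
      (Filter.Eventually.of_forall fun y => mul_nonneg (Real.sqrt_nonneg _) (abs_nonneg _))
      integrable_topNorm (Filter.Eventually.of_forall fun y => sqrt_mul_absOrd_le_topNorm y i rfl)

end TopNorm

theorem neg_log_one_sub_le {ν : ℝ} (h0 : 0 ≤ ν) (h1 : ν ≤ 1 / 2) :
    -Real.log (1 - ν) ≤ ν + ν ^ 2 / 2 + ν ^ 3 := by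
  have h := (abs_le.1 (Real.abs_log_sub_add_sum_range_le
    (show |ν| < 1 by rw [abs_of_nonneg h0]; linarith) 4)).1
  rw [abs_of_nonneg h0] at h
  have hdiv : ν ^ (4 + 1) / (1 - ν) ≤ 2 * ν ^ 5 := by
    rw [div_le_iff₀ (by linarith)]
    have := mul_nonneg (pow_nonneg h0 5) (by linarith : 0 ≤ 1 - 2 * ν)
    norm_num only
    linarith
  have h4 : ν ^ 4 ≤ ν ^ 3 * (1 / 2) := by
    rw [pow_succ]
    exact mul_le_mul_of_nonneg_left h1 (pow_nonneg h0 3)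
  have h5 : ν ^ 5 ≤ ν ^ 4 * (1 / 2) := by
    rw [pow_succ]
    exact mul_le_mul_of_nonneg_left h1 (pow_nonneg h0 4)
  norm_num [Finset.sum_range_succ] at h
  nlinarith [pow_nonneg h0 3]

/-- The exponent, per coordinate, of the tilted Chernoff bound for `topNorm`. -/
noncomputable def tiltExponent (ν σ t w δ : ℝ) : ℝ :=
  Real.log σ - ν * (1 + t) / 2 + ν * w ^ 2 + (ν * w * σ) ^ 2 / 2 - ν * w * σ * (w + δ)

theorem tiltExponent_le {ν σ t w δ : ℝ} (hν0 : 0 ≤ ν) (hν1 : ν ≤ 1 / 2) (hσ : 0 < σ)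
    (hνσ : σ ^ 2 * (1 - ν) = 1) (hw0 : 0 ≤ w) (hw1 : w ≤ 1) (hδ : 0 ≤ δ) :
    tiltExponent ν σ t w δ ≤ -(ν * t) / 2 + ν ^ 2 / 4 + ν ^ 3 - ν * (w * δ) := by
  have hlog : Real.log σ = -Real.log (1 - ν) / 2 := by
    have := congrArg Real.log hνσ
    rw [Real.log_mul (by positivity) (by linarith), Real.log_pow, Real.log_one] at this
    push_cast at this
    linarith
  have hσ1 : 1 ≤ σ := by nlinarith
  have hσν : σ - 1 ≤ ν := by
    have h2 : σ ^ 2 * ν = (σ - 1) * (σ + 1) := by linarith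
    have h3 : σ ^ 2 ≤ 2 := by nlinarith
    nlinarith
  have hsq : (σ - 1) ^ 2 ≤ ν ^ 2 := by
    exact pow_le_pow_left₀ (by linarith) hσν 2
  have hww : w ^ 2 ≤ 1 := by nlinarith
  have hmul : w ^ 2 * (σ - 1) ^ 2 ≤ ν ^ 2 := by nlinarith [sq_nonneg (σ - 1)]
  have hδσ : ν * (w * δ) ≤ ν * (w * δ) * σ :=
    le_mul_of_one_le_right (by positivity) hσ1
  have hid : ν * w ^ 2 + (ν * w * σ) ^ 2 / 2 - ν * w * σ * (w + δ) =
      ν * (w ^ 2 * (σ - 1) ^ 2) / 2 - ν * (w * δ) * σ := by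
    linear_combination (-(ν * w ^ 2) / 2) * hνσ
  have := neg_log_one_sub_le hν0 hν1
  have hνm := mul_le_mul_of_nonneg_left hmul hν0
  rw [tiltExponent, hlog]
  nlinarith

theorem exists_tiltExponent_le {t w δ : ℝ} (ht0 : 0 < t) (ht1 : t ≤ 1 / 2) (hw0 : 0 < w)
    (hw1 : w ≤ 1) (htw : 2 * t ≤ w ^ 2) (hδ : 0 ≤ δ) :
    ∃ ν σ : ℝ, 0 < ν ∧ 0 < σ ∧ σ ^ 2 * (1 - ν) = 1 ∧
      (tiltExponent ν σ t w δ ≤ -t ^ 2 / 4 ∨ tiltExponent ν σ t w δ ≤ -δ ^ 2 / 2) := by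
  have hσ : ∀ ν : ℝ, ν ≤ 1 / 2 → 0 < (√(1 - ν))⁻¹ ∧ (√(1 - ν))⁻¹ ^ 2 * (1 - ν) = 1 := by
    intro ν hν
    have : 0 < 1 - ν := by linarith
    refine ⟨inv_pos.2 (Real.sqrt_pos.2 this), ?_⟩
    rw [inv_pow, Real.sq_sqrt this.le, inv_mul_cancel₀ this.ne']
  rcases le_total (t ^ 2) (w * δ) with h | h
  · obtain ⟨h1, h2⟩ := hσ t ht1
    refine ⟨t, _, ht0, h1, h2, Or.inl ?_⟩
    have := tiltExponent_le (t := t) ht0.le ht1 h1 h2 hw0.le hw1 hδ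
    nlinarith
  · obtain ⟨h1, h2⟩ := hσ (t / 2) (by linarith)
    refine ⟨t / 2, _, by positivity, h1, h2, Or.inr ?_⟩
    have := tiltExponent_le (t := t) (by positivity) (by linarith) h1 h2 hw0.le hw1 hδ
    have h3 : (w * δ) ^ 2 ≤ (t ^ 2) ^ 2 := pow_le_pow_left₀ (by positivity) h 2
    have h4 : 2 * t * δ ^ 2 ≤ w ^ 2 * δ ^ 2 := mul_le_mul_of_nonneg_right htw (sq_nonneg δ)
    have h5 : δ ^ 2 ≤ t ^ 3 / 2 := by
      refine le_of_mul_le_mul_left (a := 2 * t) ?_ (by positivity)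
      nlinarith
    have h6 : t ^ 3 ≤ t ^ 2 * (1 / 2) := by
      rw [pow_succ]
      exact mul_le_mul_of_nonneg_left ht1 (sq_nonneg t)
    have h7 : 0 ≤ t / 2 * (w * δ) := by positivity
    nlinarith

section Chernoff

variable {m k : ℕ}

theorem lintegral_exp_neg_topNorm_le {θ c E : ℝ} (hθ : 0 ≤ θ)
    (hE : E ≤ ∫ y, topNorm k y ∂stdGaussianPi m) :
    ∫⁻ y, ENNReal.ofReal (Real.exp (c - θ * topNorm k y)) ∂stdGaussianPi m ≤
      ENNReal.ofReal (Real.exp (c + θ ^ 2 / 2 - θ * E)) := by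
  have hexp : ∀ y : Fin m → ℝ, Real.exp (c - θ * topNorm k y) =
      Real.exp c * Real.exp (-θ * topNorm k y) := fun y => by
    rw [← Real.exp_add]
    ring_nf
  simp only [hexp]
  rw [← ofReal_integral_eq_lintegral_ofReal
    ((integrable_exp_neg_mul _ measurable_topNorm topNorm_nonneg hθ).const_mul _)
    (Filter.Eventually.of_forall fun y => by positivity), integral_const_mul]
  refine ENNReal.ofReal_le_ofReal ?_
  calc _ ≤ Real.exp c * Real.exp (θ ^ 2 / 2 - θ * ∫ y, topNorm k y ∂stdGaussianPi m) := by
        gcongr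
        exact integral_exp_neg_topNorm_le hθ
    _ ≤ _ := by
        rw [← Real.exp_add, Real.exp_le_exp]
        nlinarith [mul_le_mul_of_nonneg_left hE hθ]

theorem stdGaussianPi_topNorm_le {s δ : ℝ} (hδ : 0 ≤ δ)
    (hE : s + δ ≤ ∫ y, topNorm k y ∂stdGaussianPi m) :
    stdGaussianPi m {y | topNorm k y ≤ s} ≤ ENNReal.ofReal (Real.exp (-δ ^ 2 / 2)) := by
  have hmeas : Measurable fun y : Fin m → ℝ =>
      ENNReal.ofReal (Real.exp (δ * s - δ * topNorm k y)) := by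
    have := measurable_topNorm (m := m) (k := k)
    fun_prop
  calc _ ≤ stdGaussianPi m {y | 1 ≤ ENNReal.ofReal (Real.exp (δ * s - δ * topNorm k y))} := by
        refine measure_mono fun y hy => ?_
        rw [Set.mem_ofPred_eq] at hy ⊢
        rw [ENNReal.one_le_ofReal, Real.one_le_exp_iff]
        nlinarith
    _ ≤ ∫⁻ y, ENNReal.ofReal (Real.exp (δ * s - δ * topNorm k y)) ∂stdGaussianPi m := by
        simpa using mul_meas_ge_le_lintegral hmeas 1
    _ ≤ _ := lintegral_exp_neg_topNorm_le hδ hE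
    _ = _ := by ring_nf

theorem stdGaussianPi_topNorm_sq_add_le {ν σ t w δ : ℝ} (hν : 0 ≤ ν) (hσ : 0 < σ)
    (hνσ : σ ^ 2 * (1 - ν) = 1) (hw : 0 ≤ w)
    (hE : (w + δ) * √m ≤ ∫ y, topNorm k y ∂stdGaussianPi m) :
    stdGaussianPi m {y | topNorm k y ^ 2 + (1 + t - w ^ 2) * m ≤ ∑ i, y i ^ 2} ≤
      ENNReal.ofReal (Real.exp (m * tiltExponent ν σ t w δ)) := by
  have hm : √(m : ℝ) ^ 2 = m := Real.sq_sqrt (Nat.cast_nonneg m)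
  set θ : ℝ := ν * w * √m with hθ
  set c : ℝ := ν * w ^ 2 * m - ν * (1 + t) / 2 * m with hc
  have hF : Measurable fun y : Fin m → ℝ => ENNReal.ofReal (Real.exp (c - θ * topNorm k y)) := by
    have := measurable_topNorm (m := m) (k := k)
    fun_prop
  have hG : Measurable fun y : Fin m → ℝ => ENNReal.ofReal (Real.exp (ν / 2 * ∑ i, y i ^ 2)) *
      ENNReal.ofReal (Real.exp (c - θ * topNorm k y)) :=
    Measurable.mul (by fun_prop) hF
  calc _ ≤ stdGaussianPi m {y | 1 ≤ ENNReal.ofReal (Real.exp (ν / 2 * ∑ i, y i ^ 2)) *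
          ENNReal.ofReal (Real.exp (c - θ * topNorm k y))} := by
        refine measure_mono fun y hy => ?_
        rw [Set.mem_ofPred_eq] at hy ⊢
        rw [← ENNReal.ofReal_mul (by positivity), ← Real.exp_add, ENNReal.one_le_ofReal,
          Real.one_le_exp_iff]
        have hsq : 0 ≤ ν / 2 * (topNorm k y - w * √m) ^ 2 := by positivity
        have hid : ν / 2 * (topNorm k y - w * √m) ^ 2 =
            ν / 2 * (topNorm k y ^ 2 + (1 + t - w ^ 2) * m) + (c - θ * topNorm k y) := by
          rw [hθ, hc]
          linear_combination (ν / 2 * w ^ 2) * hm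
        have := mul_le_mul_of_nonneg_left hy (by positivity : 0 ≤ ν / 2)
        linarith
    _ ≤ ∫⁻ y, ENNReal.ofReal (Real.exp (ν / 2 * ∑ i, y i ^ 2)) *
          ENNReal.ofReal (Real.exp (c - θ * topNorm k y)) ∂stdGaussianPi m := by
        simpa using mul_meas_ge_le_lintegral hG 1
    _ = ENNReal.ofReal σ ^ m * ∫⁻ y, ENNReal.ofReal
          (Real.exp (c - θ * topNorm k fun i => σ * y i)) ∂stdGaussianPi m :=
        lintegral_stdGaussianPi_tilt hσ hνσ m hF
    _ = ENNReal.ofReal σ ^ m * ∫⁻ y, ENNReal.ofReal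
          (Real.exp (c - θ * σ * topNorm k y)) ∂stdGaussianPi m := by
        simp only [topNorm_const_mul hσ.le, mul_assoc]
    _ ≤ ENNReal.ofReal σ ^ m *
          ENNReal.ofReal (Real.exp (c + (θ * σ) ^ 2 / 2 - θ * σ * ((w + δ) * √m))) := by
        gcongr
        exact lintegral_exp_neg_topNorm_le (by positivity) hE
    _ = _ := by
        rw [← ENNReal.ofReal_pow hσ.le, ← ENNReal.ofReal_mul (by positivity)]
        nth_rw 1 [← Real.exp_log hσ]
        rw [← Real.exp_nat_mul, ← Real.exp_add]
        congr 2
        rw [hθ, hc, tiltExponent]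
        linear_combination ((ν * w * σ) ^ 2 / 2 - ν * w * σ * (w + δ)) * hm

end Chernoff

section OmegaEvent

variable {m n k : ℕ} {x : Fin n → ℝ} {ε β : ℝ}

theorem topNorm_sq_add_le_of_mem_omegaEvent (hk : (k : ℝ) = β * m) (hkm : k < m)
    {A : Fin m → Fin n → ℝ} (hA : A ∈ omegaEvent m n x ε β) :
    topNorm k (fun i => ∑ j, A i j * x j) ^ 2 + (1 - ε) * (1 - β) * m ≤
      ∑ i, (∑ j, A i j * x j) ^ 2 := by
  have hle : ∀ T : Finset (Fin m), T.card = k → ∑ i ∈ T, (∑ j, A i j * x j) ^ 2 ≤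
      ∑ i, (∑ j, A i j * x j) ^ 2 - (1 - ε) * (1 - β) * m := by
    intro T hT
    have hcard : (Tᶜ.card : ℝ) = (1 - β) * m := by
      rw [Finset.card_compl, hT, Fintype.card_fin, Nat.cast_sub hkm.le, hk]
      ring
    have hpos : (0 : ℝ) < Tᶜ.card := by
      rw [Finset.card_compl, hT, Fintype.card_fin]
      exact_mod_cast Nat.sub_pos_of_lt hkm
    have h := (abs_le.1 (hA Tᶜ (by rw [compl_compl, hT, hk]))).1
    have h' : (1 - ε) ≤ subNormSq A x Tᶜ / Tᶜ.card := by
      rw [one_div_mul_eq_div] at h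
      linarith
    rw [le_div_iff₀ hpos, hcard, subNormSq] at h'
    have := Finset.sum_add_sum_compl T fun i => (∑ j, A i j * x j) ^ 2
    linarith
  obtain ⟨T, -, hT⟩ := Finset.exists_subset_card_eq
    (show k ≤ (Finset.univ : Finset (Fin m)).card by simpa using hkm.le)
  have h0 := (Finset.sum_nonneg fun i (_ : i ∈ T) => sq_nonneg _).trans (hle T hT)
  have := (Real.le_sqrt (topNorm_nonneg _) h0).1
    (topNorm_le (Real.sqrt_nonneg _) fun T hT => Real.sqrt_le_sqrt (hle T hT))
  linarith

theorem sum_sq_le_of_mem_omegaEvent (hβ : 0 ≤ β) (hm : 0 < m)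
    {A : Fin m → Fin n → ℝ} (hA : A ∈ omegaEvent m n x ε β) :
    ∑ i, (∑ j, A i j * x j) ^ 2 ≤ (1 + ε) * m := by
  have h := (abs_le.1 (hA Finset.univ (by simpa using by positivity))).2
  have hm' : (0 : ℝ) < m := Nat.cast_pos.2 hm
  rw [one_div_mul_eq_div, Finset.card_univ, Fintype.card_fin, subNormSq] at h
  rw [← div_le_iff₀ hm']
  linarith

theorem gaussianMatrix_omegaEvent_le (hx : ∑ j, x j ^ 2 = 1) {s : Set (Fin m → ℝ)}
    (hs : MeasurableSet s)
    (h : ∀ A ∈ omegaEvent m n x ε β, (fun i => ∑ j, A i j * x j) ∈ s) :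
    gaussianMatrix m n (omegaEvent m n x ε β) ≤ stdGaussianPi m s := by
  rw [← map_gaussianMatrix hx, Measure.map_apply (by fun_prop) hs]
  exact measure_mono h

end OmegaEvent

theorem omegaEvent_prob_upper (n : ℕ) (x₀ : Fin n → ℝ) (hx₀ : ∑ j, x₀ j ^ 2 = 1)
    (cg : ℝ) (hcg : 0 < cg) (hcgProp : cgProperty cg)
    (m : ℕ) (β : ℝ) (hβ0 : 0 < β) (hβ1 : β ≤ 1 / 2)
    (hβm : ∃ k : ℕ, (k : ℝ) = β * m)
    (εt : ℝ) (hεt : 0 < εt) (ε : ℝ) (hε0 : 0 < ε) (hε1 : ε ≤ 1)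
    (δ : ℝ)
    (hδdef : δ = cg * Real.sqrt (β * Real.log (2 / β)) -
      Real.sqrt ((1 - ε) * β + ε + εt))
    (hδ : 0 < δ) :
    gaussianMatrix m n (omegaEvent m n x₀ ε β) ≤
      ENNReal.ofReal (Real.exp (-εt ^ 2 * m / 4) + Real.exp (-δ ^ 2 * m / 2)) := by
  have h1a : 0 ≤ (1 - ε) * β := mul_nonneg (by linarith) hβ0.le
  rcases Nat.eq_zero_or_pos m with rfl | hm
  · have : IsProbabilityMeasure (gaussianMatrix 0 n) := by
      unfold gaussianMatrix
      infer_instance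
    refine prob_le_one.trans (ENNReal.one_le_ofReal.2 ?_)
    norm_num
  obtain ⟨k, hk⟩ := hβm
  have hm' : (0 : ℝ) < m := Nat.cast_pos.2 hm
  have hk' : (0 : ℝ) < k := by rw [hk]; positivity
  have hk0 : 0 < k := Nat.cast_pos.1 hk'
  have hkm : 2 * k ≤ m := by
    have : (2 * k : ℝ) ≤ m := by rw [hk]; nlinarith
    exact_mod_cast this
  set w : ℝ := √((1 - ε) * β + ε + εt) with hw
  have hw2 : w ^ 2 = (1 - ε) * β + ε + εt := Real.sq_sqrt (by positivity)
  have hw0 : 0 < w := Real.sqrt_pos.2 (by positivity)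
  have hE : (w + δ) * √m ≤ ∫ y, topNorm k y ∂stdGaussianPi m := by
    refine le_trans (le_of_eq ?_) (hcgProp.mul_sqrt_log_le_integral_topNorm hk0 hkm)
    have hdiv : 2 * (m : ℝ) / k = 2 / β := by
      rw [hk]
      field_simp
    rw [hdiv, hk, Real.sqrt_mul hβ0.le, hδdef, Real.sqrt_mul hβ0.le]
    ring
  have hw1 : w + δ ≤ 1 := le_of_mul_le_mul_right
    ((hE.trans integral_topNorm_le).trans_eq (one_mul _).symm) (Real.sqrt_pos.2 hm')
  have hcompl : (1 - ε) * (1 - β) = 1 + εt - w ^ 2 := by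
    rw [hw2]
    ring
  have hleft : ENNReal.ofReal (Real.exp (-εt ^ 2 * m / 4)) ≤
      ENNReal.ofReal (Real.exp (-εt ^ 2 * m / 4) + Real.exp (-δ ^ 2 * m / 2)) :=
    ENNReal.ofReal_le_ofReal (le_add_of_nonneg_right (Real.exp_nonneg _))
  have hright : ENNReal.ofReal (Real.exp (-δ ^ 2 * m / 2)) ≤
      ENNReal.ofReal (Real.exp (-εt ^ 2 * m / 4) + Real.exp (-δ ^ 2 * m / 2)) :=
    ENNReal.ofReal_le_ofReal (le_add_of_nonneg_left (Real.exp_nonneg _))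
  have htop := measurable_topNorm (m := m) (k := k)
  rcases le_total ε εt with hεεt | hεεt
  · refine le_trans ?_ hright
    calc _ ≤ stdGaussianPi m {y | topNorm k y ≤ w * √m} := by
          refine gaussianMatrix_omegaEvent_le hx₀ (measurableSet_le htop measurable_const)
            fun A hA => ?_
          have h1 := topNorm_sq_add_le_of_mem_omegaEvent hk (by omega) hA
          have h2 := sum_sq_le_of_mem_omegaEvent hβ0.le hm hA
          rw [hcompl] at h1
          rw [Set.mem_ofPred_eq]
          refine abs_le_of_sq_le_sq' ?_ (by positivity) |>.2
          rw [mul_pow, Real.sq_sqrt hm'.le]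
          nlinarith
      _ ≤ ENNReal.ofReal (Real.exp (-(δ * √m) ^ 2 / 2)) :=
          stdGaussianPi_topNorm_le (by positivity) (by linarith)
      _ = _ := by rw [mul_pow, Real.sq_sqrt hm'.le, neg_mul]
  · have hsq : w ^ 2 ≤ 1 := pow_le_one₀ hw0.le (by linarith)
    obtain ⟨ν, σ, hν, hσ, hνσ, hR⟩ := exists_tiltExponent_le (t := εt) (w := w) (δ := δ) hεt
      (by linarith) hw0 (by linarith) (by linarith) hδ.le
    have hbound : gaussianMatrix m n (omegaEvent m n x₀ ε β) ≤
        ENNReal.ofReal (Real.exp (m * tiltExponent ν σ εt w δ)) := by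
      refine (gaussianMatrix_omegaEvent_le hx₀ ?_ fun A hA => ?_).trans
        (stdGaussianPi_topNorm_sq_add_le hν.le hσ hνσ hw0.le hE)
      · exact measurableSet_le (by fun_prop) (by fun_prop)
      · have h1 := topNorm_sq_add_le_of_mem_omegaEvent hk (by omega) hA
        rwa [hcompl] at h1
    refine hbound.trans ?_
    rcases hR with hR | hR
    · refine le_trans (ENNReal.ofReal_le_ofReal (Real.exp_le_exp.2 ?_)) hleft
      nlinarith
    · refine le_trans (ENNReal.ofReal_le_ofReal (Real.exp_le_exp.2 ?_)) hright
      nlinarith
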